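/- arXiv:2308.15997 — 3 statements merged into one kernel-verified Lean document; each statement's English description precedes it below -/
import Mathlib

section
/- Let X be a centered Gaussian mixture in ℝ with representation X = Y·Z (Y almost surely positive, Z standard Gaussian independent of Y), so that X has density f(x) = E[(2πY²)^{-1/2} e^{−x²/(2Y²)}]. Then the function x ↦ log f(√x) is convex on (0,∞). -/
open MeasureTheory ProbabilityTheory

/-- Hölder's inequality in interpolation form: the integral of a weighted geometric mean is at most
the weighted geometric mean of the integrals. -/
theorem integral_rpow_mul_rpow_le {α : Type*} [MeasurableSpace α] {μ : Measure α}
    {u v : α → ℝ} (hu : Integrable u μ) (hv : Integrable v μ)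
    (hu0 : ∀ x, 0 ≤ u x) (hv0 : ∀ x, 0 ≤ v x)
    {a b : ℝ} (ha : 0 < a) (hb : 0 < b) (hab : a + b = 1) :
    ∫ x, u x ^ a * v x ^ b ∂μ ≤ (∫ x, u x ∂μ) ^ a * (∫ x, v x ∂μ) ^ b := by
  have memLp_rpow {w : α → ℝ} (hw : Integrable w μ) (hw0 : ∀ x, 0 ≤ w x) {c : ℝ} (hc : 0 < c) :
      MemLp (fun x => w x ^ c) (ENNReal.ofReal c⁻¹) μ := by
    have h := (memLp_one_iff_integrable.2 hw).norm_rpow_div (ENNReal.ofReal c)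
    rw [ENNReal.toReal_ofReal hc.le, one_div, ← ENNReal.ofReal_inv_of_pos hc] at h
    simpa only [Real.norm_of_nonneg (hw0 _)] using h
  have h := integral_mul_le_Lp_mul_Lq_of_nonneg (Real.HolderConjugate.inv_inv ha hb hab)
    (.of_forall fun x => Real.rpow_nonneg (hu0 x) a)
    (.of_forall fun x => Real.rpow_nonneg (hv0 x) b) (memLp_rpow hu hu0 ha) (memLp_rpow hv hv0 hb)
  simpa only [Real.rpow_rpow_inv (hu0 _) ha.ne', Real.rpow_rpow_inv (hv0 _) hb.ne',
    one_div, inv_inv] using h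

/-- If `X = Y Z` is a centered Gaussian mixture (with `Y` a.s. positive and `Z` a standard
Gaussian independent of `Y`), with density `f(x) = E[(2πY²)^(-1/2) exp(-x²/(2Y²))]`, then
the function `x ↦ log f(√x)` is convex on `(0, ∞)`. -/
theorem log_density_sqrt_convex_gaussian_mixture
    {Ω : Type*} [MeasurableSpace Ω] (μ : Measure Ω) [IsProbabilityMeasure μ]
    (Y Z : Ω → ℝ) (hY : Measurable Y) (hZ : Measurable Z)
    (hpos : ∀ᵐ ω ∂μ, 0 < Y ω)
    (hgauss : μ.map Z = gaussianReal 0 1)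
    (hind : IndepFun Y Z μ)
    (X : Ω → ℝ) (hX : X = fun ω => Y ω * Z ω)
    (f : ℝ → ℝ)
    (hf : ∀ x, f x =
      ∫ ω, (Real.sqrt (2 * Real.pi * Y ω ^ 2))⁻¹ * Real.exp (-(x ^ 2) / (2 * Y ω ^ 2)) ∂μ)
    (hfint : ∀ x : ℝ, Integrable
      (fun ω => (Real.sqrt (2 * Real.pi * Y ω ^ 2))⁻¹ * Real.exp (-(x ^ 2) / (2 * Y ω ^ 2))) μ) :
    ConvexOn ℝ (Set.Ioi (0 : ℝ)) (fun x => Real.log (f (Real.sqrt x))) := by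
  set k : ℝ → Ω → ℝ := fun x ω =>
    (Real.sqrt (2 * Real.pi * Y ω ^ 2))⁻¹ * Real.exp (-(x ^ 2) / (2 * Y ω ^ 2)) with hk
  have k_nonneg (x ω) : 0 ≤ k x ω := by positivity
  have f_pos (x : ℝ) : 0 < f x := by
    rw [hf, integral_pos_iff_support_of_nonneg (k_nonneg x) (hfint x)]
    have hsupp : Function.support (k x) ∈ ae μ := by
      filter_upwards [hpos] with ω hω
      have : 0 < k x ω := by positivity
      exact this.ne'
    rw [measure_of_measure_compl_eq_zero (mem_ae_iff.1 hsupp)]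
    simp
  rw [convexOn_iff_forall_pos]
  refine ⟨convex_Ioi 0, fun x (hx : 0 < x) y (hy : 0 < y) a b ha hb hab => ?_⟩
  have k_geom (ω) : k √(a • x + b • y) ω = k √x ω ^ a * k √y ω ^ b := by
    have hs : 0 ≤ (√(2 * Real.pi * Y ω ^ 2))⁻¹ := by positivity
    simp only [hk, smul_eq_mul]
    rw [Real.sq_sqrt (by positivity), Real.sq_sqrt hx.le, Real.sq_sqrt hy.le,
      Real.mul_rpow hs (Real.exp_nonneg _), Real.mul_rpow hs (Real.exp_nonneg _),
      ← Real.exp_mul, ← Real.exp_mul, mul_mul_mul_comm,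
      ← Real.rpow_add_of_nonneg hs ha.le hb.le, hab, Real.rpow_one, ← Real.exp_add]
    congr 2
    ring
  have hle : f √(a • x + b • y) ≤ f √x ^ a * f √y ^ b := by
    have h := integral_rpow_mul_rpow_le (hfint √x) (hfint √y) (k_nonneg _) (k_nonneg _) ha hb hab
    rw [hf, hf √x, hf √y]
    exact (integral_congr_ae (.of_forall k_geom)).trans_le h
  calc Real.log (f √(a • x + b • y)) ≤ Real.log (f √x ^ a * f √y ^ b) :=
        Real.log_le_log (f_pos _) hle
    _ = a • Real.log (f √x) + b • Real.log (f √y) := by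
        rw [Real.log_mul (Real.rpow_pos_of_pos (f_pos _) _).ne'
          (Real.rpow_pos_of_pos (f_pos _) _).ne', Real.log_rpow (f_pos _), Real.log_rpow (f_pos _),
          smul_eq_mul, smul_eq_mul]
end

section
/- Fix d ∈ ℕ and let f₁, f₂ be smooth probability densities on ℝ^d with finite Fisher information matrices. Then for every θ ∈ [0,1], 𝓘(θf₁ + (1−θ)f₂) ⪯ θ·𝓘(f₁) + (1−θ)·𝓘(f₂), where ⪯ is the positive semidefinite order; that is, the Fisher information matrix is operator convex on smooth densities. -/
open MeasureTheory

/-- The Fisher information matrix of a (smooth) probability density `f` on `ℝ^d`: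
`𝓘(f)ᵢⱼ = ∫ ∂ᵢf(x) ∂ⱼf(x) / f(x) dx`. -/
noncomputable def fisherMatrix (d : ℕ) (f : (Fin d → ℝ) → ℝ) : Matrix (Fin d) (Fin d) ℝ :=
  Matrix.of fun i j =>
    ∫ x, fderiv ℝ f x (Pi.single i 1) * fderiv ℝ f x (Pi.single j 1) / f x

/-- `f` is a smooth probability density on `ℝ^d`. -/
def IsSmoothDensity {d : ℕ} (f : (Fin d → ℝ) → ℝ) : Prop :=
  ContDiff ℝ (⊤ : ℕ∞) f ∧ (∀ x, 0 ≤ f x) ∧ ∫ x, f x = 1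

/-- `f` has a finite Fisher information matrix (all the defining integrals converge). -/
def HasFiniteFisherMatrix {d : ℕ} (f : (Fin d → ℝ) → ℝ) : Prop :=
  ∀ i j : Fin d, Integrable
    (fun x => fderiv ℝ f x (Pi.single i 1) * fderiv ℝ f x (Pi.single j 1) / f x)

/-- The Loewner (positive semidefinite) order on real square matrices. -/
def loewnerLE {d : ℕ} (A B : Matrix (Fin d) (Fin d) ℝ) : Prop :=
  (B - A).PosSemidef

/-- A nonnegative function has vanishing derivative at each of its zeros. -/
theorem fderiv_eq_zero_of_nonneg_of_eq_zero {E : Type*} [NormedAddCommGroup E] [NormedSpace ℝ E]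
    {f : E → ℝ} (hf : ∀ x, 0 ≤ f x) {x : E} (hx : f x = 0) : fderiv ℝ f x = 0 :=
  IsLocalMin.fderiv_eq_zero (Filter.Eventually.of_forall fun y => hx.trans_le (hf y))

/-- The perspective `(a, p) ↦ a ^ 2 / p` of the square is jointly convex, also at `p = 0`
provided that `a` vanishes there. -/
theorem sq_div_convex {θ a b p q : ℝ} (h0 : 0 ≤ θ) (h1 : θ ≤ 1) (hp : 0 ≤ p) (hq : 0 ≤ q)
    (ha : p = 0 → a = 0) (hb : q = 0 → b = 0) :
    (θ * a + (1 - θ) * b) ^ 2 / (θ * p + (1 - θ) * q) ≤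
      θ * (a ^ 2 / p) + (1 - θ) * (b ^ 2 / q) := by
  have ha' : a ^ 2 = a ^ 2 / p * p := by
    rcases eq_or_ne p 0 with h | h
    · simp [ha h, h]
    · field_simp
  have hb' : b ^ 2 = b ^ 2 / q * q := by
    rcases eq_or_ne q 0 with h | h
    · simp [hb h, h]
    · field_simp
  have hA : 0 ≤ a ^ 2 / p := by positivity
  have hB : 0 ≤ b ^ 2 / q := by positivity
  have h1' : 0 ≤ 1 - θ := sub_nonneg.2 h1
  refine div_le_of_le_mul₀ (by positivity) (by positivity) ?_
  have key : 2 * (a * b) ≤ a ^ 2 / p * q + b ^ 2 / q * p := by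
    rcases eq_or_ne p 0 with h | h
    · simp only [ha h, h]; simp
    rcases eq_or_ne q 0 with h' | h'
    · simp only [hb h', h']; simp
    have hp' : 0 < p := lt_of_le_of_ne hp h.symm
    have hq' : 0 < q := lt_of_le_of_ne hq h'.symm
    have : a ^ 2 / p * q + b ^ 2 / q * p - 2 * (a * b) = (a * q - b * p) ^ 2 / (p * q) := by
      field_simp
      ring
    have : 0 ≤ (a * q - b * p) ^ 2 / (p * q) := by positivity
    linarith
  have key' := mul_le_mul_of_nonneg_left key (mul_nonneg h0 h1')
  linear_combination key' + θ ^ 2 * ha' + (1 - θ) ^ 2 * hb'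

section FisherMatrix

variable {d : ℕ} {f : (Fin d → ℝ) → ℝ}

theorem fderiv_sq_div_eq_sum (v x : Fin d → ℝ) :
    fderiv ℝ f x v ^ 2 / f x = ∑ i, ∑ j, v i * v j *
      (fderiv ℝ f x (Pi.single i 1) * fderiv ℝ f x (Pi.single j 1) / f x) := by
  have hv : fderiv ℝ f x v = ∑ i, v i * fderiv ℝ f x (Pi.single i 1) := by
    conv_lhs => rw [← Finset.univ_sum_single v, map_sum]
    refine Finset.sum_congr rfl fun i _ => ?_
    rw [← smul_eq_mul, ← map_smul, ← Pi.single_smul, smul_eq_mul, mul_one]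
  rw [hv, sq, Finset.sum_mul_sum, Finset.sum_div]
  refine Finset.sum_congr rfl fun i _ => ?_
  rw [Finset.sum_div]
  exact Finset.sum_congr rfl fun j _ => by ring

theorem HasFiniteFisherMatrix.integrable_sq_div (hf : HasFiniteFisherMatrix f) (v : Fin d → ℝ) :
    Integrable fun x => fderiv ℝ f x v ^ 2 / f x := by
  simp_rw [fderiv_sq_div_eq_sum]
  exact integrable_finsetSum _ fun i _ => integrable_finsetSum _ fun j _ => (hf i j).const_mul _

/-- The quadratic form of the Fisher information matrix is the directional Fisher information. -/
theorem HasFiniteFisherMatrix.dotProduct_mulVec (hf : HasFiniteFisherMatrix f) (v : Fin d → ℝ) :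
    v ⬝ᵥ (fisherMatrix d f).mulVec v = ∫ x, fderiv ℝ f x v ^ 2 / f x := by
  simp_rw [fderiv_sq_div_eq_sum]
  rw [integral_finsetSum _ fun i _ => integrable_finsetSum _ fun j _ => (hf i j).const_mul _]
  refine Finset.sum_congr rfl fun i _ => ?_
  rw [integral_finsetSum _ fun j _ => (hf i j).const_mul _, Matrix.mulVec, dotProduct,
    Finset.mul_sum]
  refine Finset.sum_congr rfl fun j _ => ?_
  rw [integral_const_mul, fisherMatrix, Matrix.of_apply]
  ring

theorem fisherMatrix_isHermitian (f : (Fin d → ℝ) → ℝ) : (fisherMatrix d f).IsHermitian := by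
  ext i j
  simp [fisherMatrix, mul_comm]

/-- Finiteness of the Fisher information matrix follows from that of its diagonal. -/
theorem HasFiniteFisherMatrix.of_diagonal (hf : ContDiff ℝ 1 f) (hf0 : ∀ x, 0 ≤ f x)
    (h : ∀ i, Integrable fun x => fderiv ℝ f x (Pi.single i 1) ^ 2 / f x) :
    HasFiniteFisherMatrix f := by
  intro i j
  have hD (k : Fin d) : Measurable fun x => fderiv ℝ f x (Pi.single k 1) :=
    ((hf.continuous_fderiv one_ne_zero).clm_apply continuous_const).measurable
  refine ((h i).add (h j)).mono'
    (((hD i).mul (hD j)).div hf.continuous.measurable).aestronglyMeasurable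
    (Filter.Eventually.of_forall fun x => ?_)
  rw [Real.norm_eq_abs, abs_div, abs_of_nonneg (hf0 x), Pi.add_apply, ← add_div]
  refine div_le_div_of_nonneg_right ?_ (hf0 x)
  rw [abs_le]
  constructor <;> nlinarith [sq_nonneg (fderiv ℝ f x (Pi.single i 1)),
    sq_nonneg (fderiv ℝ f x (Pi.single j 1)),
    sq_nonneg (fderiv ℝ f x (Pi.single i 1) + fderiv ℝ f x (Pi.single j 1)),
    sq_nonneg (fderiv ℝ f x (Pi.single i 1) - fderiv ℝ f x (Pi.single j 1))]

/-- The directional Fisher information density of a mixture is at most the mixture of the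
directional Fisher information densities. -/
theorem fderiv_mixture_sq_div_le {f₁ f₂ : (Fin d → ℝ) → ℝ} (h₁ : Differentiable ℝ f₁)
    (h₂ : Differentiable ℝ f₂) (h₁0 : ∀ x, 0 ≤ f₁ x) (h₂0 : ∀ x, 0 ≤ f₂ x)
    {θ : ℝ} (hθ : θ ∈ Set.Icc (0 : ℝ) 1) (v x : Fin d → ℝ) :
    fderiv ℝ (fun x => θ * f₁ x + (1 - θ) * f₂ x) x v ^ 2 / (θ * f₁ x + (1 - θ) * f₂ x) ≤
      θ * (fderiv ℝ f₁ x v ^ 2 / f₁ x) + (1 - θ) * (fderiv ℝ f₂ x v ^ 2 / f₂ x) := by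
  have hD := (((h₁ x).hasFDerivAt.const_mul θ).fun_add
    ((h₂ x).hasFDerivAt.const_mul (1 - θ))).fderiv
  rw [hD]
  exact sq_div_convex hθ.1 hθ.2 (h₁0 x) (h₂0 x)
    (fun h => by simp [fderiv_eq_zero_of_nonneg_of_eq_zero h₁0 h])
    (fun h => by simp [fderiv_eq_zero_of_nonneg_of_eq_zero h₂0 h])

end FisherMatrix

/-- The Fisher information matrix is operator convex on smooth probability densities:
`𝓘(θ f₁ + (1-θ) f₂) ⪯ θ 𝓘(f₁) + (1-θ) 𝓘(f₂)`. -/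
theorem fisherMatrix_operator_convex
    (d : ℕ) (f₁ f₂ : (Fin d → ℝ) → ℝ)
    (h₁ : IsSmoothDensity f₁) (h₂ : IsSmoothDensity f₂)
    (hI₁ : HasFiniteFisherMatrix f₁) (hI₂ : HasFiniteFisherMatrix f₂)
    (θ : ℝ) (hθ : θ ∈ Set.Icc (0 : ℝ) 1) :
    loewnerLE (fisherMatrix d (fun x => θ * f₁ x + (1 - θ) * f₂ x))
      (θ • fisherMatrix d f₁ + (1 - θ) • fisherMatrix d f₂) := by
  obtain ⟨hs₁, h₁0, -⟩ := h₁
  obtain ⟨hs₂, h₂0, -⟩ := h₂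
  have hθ' : 0 ≤ 1 - θ := sub_nonneg.2 hθ.2
  have hc₁ : ContDiff ℝ 1 f₁ := hs₁.of_le (by exact_mod_cast le_top)
  have hc₂ : ContDiff ℝ 1 f₂ := hs₂.of_le (by exact_mod_cast le_top)
  have hc : ContDiff ℝ 1 fun x => θ * f₁ x + (1 - θ) * f₂ x :=
    (contDiff_const.mul hc₁).add (contDiff_const.mul hc₂)
  have h0 (x : Fin d → ℝ) : 0 ≤ θ * f₁ x + (1 - θ) * f₂ x :=
    add_nonneg (mul_nonneg hθ.1 (h₁0 x)) (mul_nonneg hθ' (h₂0 x))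
  have hle := fderiv_mixture_sq_div_le (hc₁.differentiable one_ne_zero)
    (hc₂.differentiable one_ne_zero) h₁0 h₂0 hθ
  have hint (v : Fin d → ℝ) := ((hI₁.integrable_sq_div v).const_mul θ).fun_add
    ((hI₂.integrable_sq_div v).const_mul (1 - θ))
  have hI : HasFiniteFisherMatrix fun x => θ * f₁ x + (1 - θ) * f₂ x := by
    refine .of_diagonal hc h0 fun i => (hint (Pi.single i 1)).mono' ?_ ?_
    · exact ((((hc.continuous_fderiv one_ne_zero).clm_apply
        continuous_const).measurable.pow_const 2).div
        hc.continuous.measurable).aestronglyMeasurable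
    · refine Filter.Eventually.of_forall fun x => ?_
      rw [Real.norm_of_nonneg (div_nonneg (sq_nonneg _) (h0 x))]
      exact hle _ x
  refine Matrix.PosSemidef.of_dotProduct_mulVec_nonneg
    ((((fisherMatrix_isHermitian f₁).smul (.all θ)).add
      ((fisherMatrix_isHermitian f₂).smul (.all (1 - θ)))).sub (fisherMatrix_isHermitian _))
    fun v => ?_
  rw [star_trivial, Matrix.sub_mulVec, Matrix.add_mulVec, Matrix.smul_mulVec, Matrix.smul_mulVec,
    dotProduct_sub, dotProduct_add, dotProduct_smul, dotProduct_smul, hI.dotProduct_mulVec,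
    hI₁.dotProduct_mulVec, hI₂.dotProduct_mulVec, smul_eq_mul, smul_eq_mul, sub_nonneg,
    ← integral_const_mul, ← integral_const_mul,
    ← integral_add ((hI₁.integrable_sq_div v).const_mul _)
      ((hI₂.integrable_sq_div v).const_mul _)]
  exact integral_mono (hI.integrable_sq_div v) (hint v) (hle v)
end

section
/- Fix d ∈ ℕ and let X be a random vector in ℝ^d which is a centered Gaussian mixture with representation X = 𝐘·Z, where 𝐘 is an almost surely positive definite random d×d matrix and Z is a standard Gaussian vector in ℝ^d independent of 𝐘. Assume E‖(𝐘𝐘ᵀ)^{-1}‖_op < ∞. Then the Fisher information matrix of X satisfies 𝓘(X) ⪯ E[(𝐘𝐘ᵀ)^{-1}] in the positive semidefinite order. -/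
open MeasureTheory ProbabilityTheory Matrix
open scoped Classical

instance matrixMeasurableSpace {m n : Type*} : MeasurableSpace (Matrix m n ℝ) :=
  inferInstanceAs (MeasurableSpace (m → n → ℝ))

/-- The standard Gaussian measure on `ℝ^d`. -/
noncomputable def stdGaussianPi (d : ℕ) : Measure (Fin d → ℝ) :=
  Measure.pi fun _ => gaussianReal 0 1

/-- The Fisher information matrix of a probability distribution `ν` on `ℝ^d` admitting a smooth
density with respect to Lebesgue measure.  (A smooth density of a measure, when it exists, is
unique, so this does not depend on the choice made; measures without a smooth density are
assigned the junk value `0`.) -/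
noncomputable def fisherInfoOfMeasure (d : ℕ) (ν : Measure (Fin d → ℝ)) :
    Matrix (Fin d) (Fin d) ℝ :=
  if h : ∃ f : (Fin d → ℝ) → ℝ, ContDiff ℝ (⊤ : ℕ∞) f ∧
      ν = volume.withDensity (fun x => ENNReal.ofReal (f x)) then
    fisherMatrix d h.choose
  else 0

/-- The operator (spectral) norm of a real `d × d` matrix. -/
noncomputable def matOpNorm {d : ℕ} (A : Matrix (Fin d) (Fin d) ℝ) : ℝ :=
  ‖Matrix.toEuclideanCLM (𝕜 := ℝ) A‖

theorem stdGaussianPi_eq_withDensity (d : ℕ) :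
    stdGaussianPi d =
      volume.withDensity (fun z => ENNReal.ofReal (∏ i, gaussianPDFReal 0 1 (z i))) := by
  refine Measure.pi_eq fun s hs => ?_
  rw [withDensity_apply _ (MeasurableSet.univ_pi hs), volume_pi, Measure.restrict_pi_pi,
    ← ofReal_integral_eq_lintegral_ofReal
      (Integrable.fintype_prod fun i => (integrable_gaussianPDFReal 0 1).integrableOn)
      (ae_of_all _ fun z => Finset.prod_nonneg fun i _ => gaussianPDFReal_nonneg 0 1 (z i)),
    integral_fintype_prod_eq_prod (fun _ => gaussianPDFReal 0 1),
    ENNReal.ofReal_prod_of_nonneg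
      fun i _ => integral_nonneg fun x => gaussianPDFReal_nonneg 0 1 x]
  exact Finset.prod_congr rfl fun i _ =>
    (gaussianReal_apply_eq_integral 0 one_ne_zero (s i)).symm

theorem hasFDerivAt_prod_gaussianPDFReal (d : ℕ) (z : Fin d → ℝ) :
    HasFDerivAt (fun z : Fin d → ℝ => ∏ i, gaussianPDFReal 0 1 (z i))
      (-(∏ i, gaussianPDFReal 0 1 (z i)) •
        ∑ i, z i • ContinuousLinearMap.proj (R := ℝ) (φ := fun _ : Fin d => ℝ) i) z := by
  have hform : (fun z : Fin d → ℝ => ∏ i, gaussianPDFReal 0 1 (z i)) =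
      fun z => (∏ _i : Fin d, (√(2 * Real.pi))⁻¹) * Real.exp (∑ i, -(z i) ^ 2 / 2) := by
    ext z
    simp [gaussianPDFReal, Finset.prod_mul_distrib, Real.exp_sum]
  have hq : HasFDerivAt (fun z : Fin d → ℝ => ∑ i, -(z i) ^ 2 / 2)
      (∑ i, -z i • ContinuousLinearMap.proj (R := ℝ) (φ := fun _ : Fin d => ℝ) i) z := by
    refine HasFDerivAt.fun_sum fun i _ => ?_
    have h1 : HasDerivAt (fun t : ℝ => -t ^ 2 / 2) (-z i) (z i) := by
      refine ((hasDerivAt_pow 2 (z i)).fun_neg.div_const 2).congr_deriv ?_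
      norm_num
      ring
    exact h1.comp_hasFDerivAt (f := fun z : Fin d → ℝ => z i) z (hasFDerivAt_apply i z)
  have h := (hq.exp).const_mul (∏ _i : Fin d, (√(2 * Real.pi))⁻¹)
  have hz := congrFun hform z
  rw [hform, hz]
  refine h.congr_fderiv ?_
  ext w
  simp [mul_assoc]

/-- Stein's identity for the standard Gaussian measure. -/
theorem integral_fderiv_stdGaussianPi {d : ℕ} {g : (Fin d → ℝ) → ℝ} (hg : ContDiff ℝ 1 g)
    (hgs : HasCompactSupport g) (w : Fin d → ℝ) :
    ∫ z, fderiv ℝ g z w ∂stdGaussianPi d = ∫ z, g z * (w ⬝ᵥ z) ∂stdGaussianPi d := by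
  set ρ : (Fin d → ℝ) → ℝ := fun z => ∏ i, gaussianPDFReal 0 1 (z i) with hρ
  have hρd : ∀ z, fderiv ℝ ρ z w = -(w ⬝ᵥ z) * ρ z := by
    intro z
    rw [(hasFDerivAt_prod_gaussianPDFReal d z).fderiv]
    simp [hρ, dotProduct, mul_comm]
  have hρdiff : Differentiable ℝ ρ := fun z =>
    (hasFDerivAt_prod_gaussianPDFReal d z).differentiableAt
  have hρ0 : ∀ z, 0 ≤ ρ z := fun z =>
    Finset.prod_nonneg fun i _ => gaussianPDFReal_nonneg 0 1 (z i)
  have hρc : Continuous ρ := hρdiff.continuous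
  have hdot : Continuous fun z : Fin d → ℝ => w ⬝ᵥ z := by
    unfold dotProduct
    fun_prop
  have hg'c : Continuous fun z => fderiv ℝ g z w :=
    (hg.continuous_fderiv one_ne_zero).clm_apply continuous_const
  have hwd : ∀ F : (Fin d → ℝ) → ℝ, ∫ z, F z ∂stdGaussianPi d = ∫ z, ρ z * F z := by
    intro F
    rw [stdGaussianPi_eq_withDensity, integral_withDensity_eq_integral_toReal_smul
      (by exact (hρc.measurable.ennreal_ofReal)) (ae_of_all _ fun z => ENNReal.ofReal_lt_top)]
    refine integral_congr_ae (ae_of_all _ fun z => ?_)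
    simp only [smul_eq_mul]
    rw [ENNReal.toReal_ofReal (hρ0 z)]
  have hibp := integral_mul_fderiv_eq_neg_fderiv_mul_of_integrable (μ := volume) (f := ρ) (g := g)
    (v := w) ?_ ?_ ?_ (fun z _ => hρdiff z) (fun z _ => hg.differentiable one_ne_zero z)
  · rw [hwd, hwd, hibp, ← integral_neg]
    refine integral_congr_ae (ae_of_all _ fun z => ?_)
    simp only [hρd]
    ring
  · simp_rw [hρd]
    exact ((hdot.neg.mul hρc).mul hg.continuous).integrable_of_hasCompactSupport hgs.mul_left
  · exact (hρc.mul hg'c).integrable_of_hasCompactSupport (hgs.fderiv_apply ℝ w).mul_left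
  · exact (hρc.mul hg.continuous).integrable_of_hasCompactSupport hgs.mul_left

instance (d : ℕ) : IsProbabilityMeasure (stdGaussianPi d) :=
  inferInstanceAs (IsProbabilityMeasure (Measure.pi fun _ => gaussianReal 0 1))

instance (d : ℕ) : (stdGaussianPi d).IsOpenPosMeasure := by
  have : (gaussianReal 0 1).IsOpenPosMeasure :=
    (gaussianReal_absolutelyContinuous' 0 one_ne_zero).isOpenPosMeasure
  exact inferInstanceAs (Measure.pi fun _ : Fin d => gaussianReal 0 1).IsOpenPosMeasure

theorem memLp_dotProduct_stdGaussianPi {d : ℕ} (w : Fin d → ℝ) :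
    MemLp (fun z => w ⬝ᵥ z) 2 (stdGaussianPi d) := by
  unfold dotProduct
  refine memLp_finsetSum _ fun i _ => MemLp.const_mul ?_ (w i)
  exact (memLp_id_gaussianReal' 2 (by simp)).comp_measurePreserving
    (measurePreserving_eval (fun _ : Fin d => gaussianReal 0 1) i)

theorem integral_dotProduct_sq_stdGaussianPi {d : ℕ} (w : Fin d → ℝ) :
    ∫ z, (w ⬝ᵥ z) ^ 2 ∂stdGaussianPi d = w ⬝ᵥ w := by
  have hmean : ∫ z, w ⬝ᵥ z ∂stdGaussianPi d = 0 := by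
    unfold dotProduct
    have hint : ∀ i, ∫ z : Fin d → ℝ, z i ∂stdGaussianPi d = 0 := fun i =>
      (integral_comp_eval (μ := fun _ : Fin d => gaussianReal 0 1) (i := i) (f := fun x : ℝ => x)
        aestronglyMeasurable_id).trans integral_id_gaussianReal
    rw [integral_finsetSum]
    · simp [integral_const_mul, hint]
    · intro i _
      exact (((memLp_id_gaussianReal' 1 (by simp)).comp_measurePreserving
        (measurePreserving_eval (fun _ : Fin d => gaussianReal 0 1) i)).integrable
          le_rfl).const_mul _
  have hvar := variance_of_integral_eq_zero
    (memLp_dotProduct_stdGaussianPi w).aestronglyMeasurable.aemeasurable hmean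
  have hpi := variance_sum_pi (μ := fun _ : Fin d => gaussianReal 0 1)
    (X := fun i x => w i * x) fun i => (memLp_id_gaussianReal' 2 (by simp)).const_mul (w i)
  have hfun : (∑ i, fun z : Fin d → ℝ => w i * z i) = fun z => w ⬝ᵥ z := by
    ext z
    simp [dotProduct]
  rw [← hvar, ← hfun]
  refine hpi.trans ?_
  refine Finset.sum_congr rfl fun i _ => ?_
  rw [variance_const_mul, variance_fun_id_gaussianReal]
  simp [sq]

theorem norm_sq_eq_integral_sq {α : Type*} [MeasurableSpace α] {m : Measure α} (u : Lp ℝ 2 m) :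
    ‖u‖ ^ 2 = ∫ x, u x ^ 2 ∂m := by
  rw [← real_inner_self_eq_norm_sq, L2.inner_def]
  simp [sq]

/-- For `W ∈ L²(P)` and `T` pushing `P` forward to `ν`, the conditional expectation of `W` given
`T` is represented by a function `s ∈ L²(ν)` of no larger norm. -/
theorem exists_memLp_integral_comp_mul_eq {α β : Type*} [MeasurableSpace α] [MeasurableSpace β]
    {P : Measure α} {ν : Measure β} {T : α → β} (hT : MeasurePreserving T P ν)
    {W : α → ℝ} (hW : MemLp W 2 P) :
    ∃ s : β → ℝ, Measurable s ∧ MemLp s 2 ν ∧ ∫ x, s x ^ 2 ∂ν ≤ ∫ ω, W ω ^ 2 ∂P ∧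
      ∀ ψ : β → ℝ, MemLp ψ 2 ν → ∫ ω, ψ (T ω) * W ω ∂P = ∫ x, ψ x * s x ∂ν := by
  let J : Lp ℝ 2 ν →L[ℝ] Lp ℝ 2 P :=
    (Lp.compMeasurePreservingₗᵢ ℝ T hT).toContinuousLinearMap
  let S : Lp ℝ 2 ν := J.adjoint (hW.toLp W)
  obtain ⟨s, hs, hSs⟩ := (Lp.aestronglyMeasurable S).aemeasurable
  refine ⟨s, hs, (memLp_congr_ae hSs).1 (Lp.memLp S), ?_, fun ψ hψ => ?_⟩
  · have hJ : ‖S‖ ≤ ‖hW.toLp W‖ := by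
      refine (J.adjoint.le_opNorm _).trans ?_
      rw [LinearIsometryEquiv.norm_map]
      exact mul_le_of_le_one_left (norm_nonneg _)
        (LinearIsometry.norm_toContinuousLinearMap_le _)
    have hle := pow_le_pow_left₀ (norm_nonneg _) hJ 2
    rw [norm_sq_eq_integral_sq, norm_sq_eq_integral_sq] at hle
    refine (integral_congr_ae ?_).trans_le (hle.trans_eq (integral_congr_ae ?_))
    · filter_upwards [hSs] with x hx
      rw [hx]
    · filter_upwards [hW.coeFn_toLp] with x hx
      rw [hx]
  · have h : inner ℝ (J (hψ.toLp ψ)) (hW.toLp W) = inner ℝ (hψ.toLp ψ) S :=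
      (J.adjoint_inner_right _ _).symm
    rw [L2.inner_def, L2.inner_def] at h
    refine (integral_congr_ae ?_).trans (h.trans (integral_congr_ae ?_))
    · filter_upwards [hW.coeFn_toLp, Lp.coeFn_compMeasurePreserving (hψ.toLp ψ) hT,
        hT.quasiMeasurePreserving.ae hψ.coeFn_toLp] with x hx hx' hx''
      have hJx : J (hψ.toLp ψ) x = ψ (T x) := hx'.trans hx''
      rw [hJx, hx]
      simp [mul_comm]
    · filter_upwards [hψ.coeFn_toLp, hSs] with x hx hx'
      rw [hx, hx']
      simp [mul_comm]

/-- If integration by parts in direction `v` for the law of `T` is realised by a weight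
`W ∈ L²(P)`, the directional Fisher information of that law is at most `E[W²]`. -/
theorem fisher_directional_bound {d : ℕ} {α : Type*} [MeasurableSpace α] {P : Measure α}
    [IsFiniteMeasure P] {f : (Fin d → ℝ) → ℝ} (hf : ContDiff ℝ 1 f) (hf0 : ∀ x, 0 ≤ f x)
    {T : α → Fin d → ℝ}
    (hT : MeasurePreserving T P (volume.withDensity fun x => ENNReal.ofReal (f x)))
    {W : α → ℝ} (hW : MemLp W 2 P) (v : Fin d → ℝ)
    (hTW : ∀ ψ : (Fin d → ℝ) → ℝ, ContDiff ℝ 1 ψ → HasCompactSupport ψ →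
      ∫ ω, fderiv ℝ ψ (T ω) v ∂P = ∫ ω, ψ (T ω) * W ω ∂P) :
    Integrable (fun x => fderiv ℝ f x v ^ 2 / f x) ∧
      ∫ x, fderiv ℝ f x v ^ 2 / f x ≤ ∫ ω, W ω ^ 2 ∂P := by
  set ν := volume.withDensity fun x => ENNReal.ofReal (f x) with hν
  have : IsFiniteMeasure ν := by
    rw [← hT.map_eq]
    infer_instance
  have hfm : Measurable fun x => ENNReal.ofReal (f x) :=
    hf.continuous.measurable.ennreal_ofReal
  have hlt : ∀ᵐ x : Fin d → ℝ, ENNReal.ofReal (f x) < ⊤ :=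
    ae_of_all _ fun x => ENNReal.ofReal_lt_top
  have hwd : ∀ F : (Fin d → ℝ) → ℝ, ∫ x, F x ∂ν = ∫ x, F x * f x := by
    intro F
    rw [hν, integral_withDensity_eq_integral_toReal_smul hfm hlt]
    refine integral_congr_ae (ae_of_all _ fun z => ?_)
    simp only [smul_eq_mul]
    rw [ENNReal.toReal_ofReal (hf0 z), mul_comm]
  have hwi : ∀ F : (Fin d → ℝ) → ℝ, Integrable F ν → Integrable fun x => F x * f x := by
    intro F hF
    rw [hν, integrable_withDensity_iff_integrable_smul₀' hfm.aemeasurable hlt] at hF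
    refine hF.congr (ae_of_all _ fun z => ?_)
    simp only [smul_eq_mul]
    rw [ENNReal.toReal_ofReal (hf0 z), mul_comm]
  obtain ⟨s, -, hs, hsW, hsψ⟩ := exists_memLp_integral_comp_mul_eq hT hW
  have hf'c : Continuous fun x => fderiv ℝ f x v :=
    (hf.continuous_fderiv one_ne_zero).clm_apply continuous_const
  have hscore : ∀ᵐ x, fderiv ℝ f x v = -(s x * f x) := by
    refine ae_eq_of_integral_contDiff_smul_eq hf'c.locallyIntegrable
      (hwi s (hs.integrable one_le_two)).neg.locallyIntegrable fun ψ hψ hψs => ?_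
    have hψ1 : ContDiff ℝ 1 ψ := hψ.of_le (by norm_cast)
    have hψ'c : Continuous fun x => fderiv ℝ ψ x v :=
      (hψ1.continuous_fderiv one_ne_zero).clm_apply continuous_const
    have hibp := integral_mul_fderiv_eq_neg_fderiv_mul_of_integrable (μ := volume) (f := ψ)
      (g := f) (v := v)
      ((hψ'c.mul hf.continuous).integrable_of_hasCompactSupport
        (hψs.fderiv_apply ℝ v).mul_right)
      ((hψ1.continuous.mul hf'c).integrable_of_hasCompactSupport hψs.mul_right)
      ((hψ1.continuous.mul hf.continuous).integrable_of_hasCompactSupport hψs.mul_right)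
      (fun z _ => hψ1.differentiable one_ne_zero z) (fun z _ => hf.differentiable one_ne_zero z)
    have hmap : ∫ ω, fderiv ℝ ψ (T ω) v ∂P = ∫ x, fderiv ℝ ψ x v ∂ν := by
      rw [← hT.map_eq, integral_map hT.aemeasurable hψ'c.aestronglyMeasurable]
    simp only [smul_eq_mul, mul_neg]
    rw [hibp, integral_neg, ← hwd, ← hmap, hTW ψ hψ1 hψs,
      hsψ ψ (hψ1.continuous.memLp_of_hasCompactSupport hψs), hwd]
    simp only [mul_assoc]
  have hae : (fun x => fderiv ℝ f x v ^ 2 / f x) =ᵐ[volume] fun x => s x ^ 2 * f x := by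
    filter_upwards [hscore] with x hx
    rw [hx]
    rcases eq_or_ne (f x) 0 with h | h
    · simp [h]
    · field_simp
  refine ⟨(hwi _ hs.integrable_sq).congr hae.symm, ?_⟩
  rw [integral_congr_ae hae, ← hwd]
  exact hsW

/-- Stein's identity for the image of the standard Gaussian measure under an invertible matrix. -/
theorem integral_fderiv_comp_mulVec_stdGaussianPi {d : ℕ} {M : Matrix (Fin d) (Fin d) ℝ}
    (hM : IsUnit M.det) {ψ : (Fin d → ℝ) → ℝ} (hψ : ContDiff ℝ 1 ψ) (hψs : HasCompactSupport ψ)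
    (v : Fin d → ℝ) :
    ∫ z, fderiv ℝ ψ (M *ᵥ z) v ∂stdGaussianPi d =
      ∫ z, ψ (M *ᵥ z) * ((M⁻¹ *ᵥ v) ⬝ᵥ z) ∂stdGaussianPi d := by
  let L : (Fin d → ℝ) →L[ℝ] (Fin d → ℝ) := LinearMap.toContinuousLinearMap M.mulVecLin
  have hL : ∀ z, L z = M *ᵥ z := fun z => rfl
  let e : (Fin d → ℝ) ≃ₜ (Fin d → ℝ) :=
    { toFun := fun z => M *ᵥ z
      invFun := fun z => M⁻¹ *ᵥ z
      left_inv := fun z => by simp [Matrix.nonsing_inv_mul M hM]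
      right_inv := fun z => by simp [Matrix.mul_nonsing_inv M hM]
      continuous_toFun := Continuous.matrix_mulVec continuous_const continuous_id
      continuous_invFun := Continuous.matrix_mulVec continuous_const continuous_id }
  have hg : ContDiff ℝ 1 fun z => ψ (M *ᵥ z) := hψ.comp L.contDiff
  have hgs : HasCompactSupport fun z => ψ (M *ᵥ z) := hψs.comp_homeomorph e
  rw [← integral_fderiv_stdGaussianPi hg hgs]
  refine integral_congr_ae (ae_of_all _ fun z => ?_)
  have hd : HasFDerivAt (fun z => ψ (M *ᵥ z)) ((fderiv ℝ ψ (M *ᵥ z)).comp L) z :=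
    ((hψ.differentiable one_ne_zero) (M *ᵥ z)).hasFDerivAt.comp z L.hasFDerivAt
  simp only [hd.fderiv, ContinuousLinearMap.comp_apply, hL]
  rw [Matrix.mulVec_mulVec, Matrix.mul_nonsing_inv M hM, Matrix.one_mulVec]

theorem measurable_matrix_apply {m n : Type*} (i : m) (j : n) :
    Measurable fun M : Matrix m n ℝ => M i j :=
  (measurable_pi_apply j).comp (measurable_pi_apply (X := fun _ : m => n → ℝ) i)

theorem measurable_matrix_of_apply {m n α : Type*} [MeasurableSpace α] {F : α → Matrix m n ℝ}
    (h : ∀ i j, Measurable fun a => F a i j) : Measurable F :=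
  measurable_pi_lambda (X := fun _ : m => n → ℝ) F fun i => measurable_pi_lambda _ fun j => h i j

theorem measurable_matrix_det {n : Type*} [Fintype n] [DecidableEq n] :
    Measurable fun M : Matrix n n ℝ => M.det := by
  simp only [Matrix.det_apply']
  exact Finset.measurable_fun_sum _ fun σ _ => measurable_const.mul <|
    Finset.measurable_fun_prod _ fun i _ => measurable_matrix_apply _ _

theorem measurable_matrix_inv {n : Type*} [Fintype n] [DecidableEq n] :
    Measurable fun M : Matrix n n ℝ => M⁻¹ := by
  refine measurable_matrix_of_apply fun i j => ?_
  simp only [Matrix.inv_def, Matrix.smul_apply, Ring.inverse_eq_inv', smul_eq_mul,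
    Matrix.adjugate_apply]
  refine measurable_matrix_det.inv.mul (measurable_matrix_det.comp ?_)
  refine measurable_matrix_of_apply fun k l => ?_
  simp only [Matrix.updateRow_apply]
  split_ifs
  · exact measurable_const
  · exact measurable_matrix_apply k l

theorem Measurable.matrix_mulVec {m n α : Type*} [Fintype n] [MeasurableSpace α]
    {F : α → Matrix m n ℝ} {u : α → n → ℝ} (hF : Measurable F) (hu : Measurable u) :
    Measurable fun a => F a *ᵥ u a := by
  refine measurable_pi_lambda _ fun i => ?_
  simp only [Matrix.mulVec, dotProduct]
  exact Finset.measurable_fun_sum _ fun j _ =>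
    ((measurable_matrix_apply i j).comp hF).mul ((measurable_pi_apply j).comp hu)

theorem Measurable.dotProduct {n α : Type*} [Fintype n] [MeasurableSpace α]
    {u w : α → n → ℝ} (hu : Measurable u) (hw : Measurable w) :
    Measurable fun a => u a ⬝ᵥ w a :=
  Finset.measurable_fun_sum _ fun j _ =>
    ((measurable_pi_apply j).comp hu).mul ((measurable_pi_apply j).comp hw)

theorem abs_apply_le_matOpNorm {d : ℕ} (A : Matrix (Fin d) (Fin d) ℝ) (i j : Fin d) :
    |A i j| ≤ matOpNorm A := by
  have h : (Matrix.toEuclideanCLM (𝕜 := ℝ) A (EuclideanSpace.single j 1)) i = A i j := by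
    simp
  calc |A i j| = ‖(Matrix.toEuclideanCLM (𝕜 := ℝ) A (EuclideanSpace.single j 1)) i‖ := by
        rw [h, Real.norm_eq_abs]
    _ ≤ ‖Matrix.toEuclideanCLM (𝕜 := ℝ) A (EuclideanSpace.single j 1)‖ :=
        PiLp.norm_apply_le _ i
    _ ≤ matOpNorm A * ‖EuclideanSpace.single j (1 : ℝ)‖ := ContinuousLinearMap.le_opNorm _ _
    _ = matOpNorm A := by simp

theorem dotProduct_inv_mul_transpose_mulVec {n : Type*} [Fintype n] [DecidableEq n]
    (M : Matrix n n ℝ) (v : n → ℝ) :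
    v ⬝ᵥ (M * Mᵀ)⁻¹ *ᵥ v = (M⁻¹ *ᵥ v) ⬝ᵥ (M⁻¹ *ᵥ v) := by
  rw [Matrix.mul_inv_rev, ← Matrix.transpose_nonsing_inv, ← Matrix.mulVec_mulVec,
    Matrix.dotProduct_mulVec, Matrix.vecMul_transpose]

theorem dotProduct_integral_mulVec {n α : Type*} [Fintype n] [MeasurableSpace α] {m : Measure α}
    {F : α → Matrix n n ℝ} (hF : ∀ i j, Integrable (fun a => F a i j) m) (v : n → ℝ) :
    Integrable (fun a => v ⬝ᵥ F a *ᵥ v) m ∧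
      v ⬝ᵥ (Matrix.of fun i j => ∫ a, F a i j ∂m) *ᵥ v = ∫ a, v ⬝ᵥ F a *ᵥ v ∂m := by
  simp only [dotProduct, Matrix.mulVec, Matrix.of_apply]
  have hi : ∀ i, Integrable (fun a => v i * ∑ j, F a i j * v j) m := fun i =>
    (integrable_finsetSum _ fun j _ => (hF i j).mul_const _).const_mul _
  refine ⟨integrable_finsetSum _ fun i _ => hi i, ?_⟩
  rw [integral_finsetSum _ fun i _ => hi i]
  refine Finset.sum_congr rfl fun i _ => ?_
  rw [integral_const_mul, integral_finsetSum _ fun j _ => (hF i j).mul_const _]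
  simp only [integral_mul_const]

theorem nonneg_of_withDensity_isOpenPosMeasure {E : Type*} [TopologicalSpace E]
    [MeasurableSpace E] [OpensMeasurableSpace E] {m : Measure E} {f : E → ℝ} (hf : Continuous f)
    [(m.withDensity fun x => ENNReal.ofReal (f x)).IsOpenPosMeasure] (x : E) : 0 ≤ f x := by
  by_contra! hx
  have hU : IsOpen {y | f y < 0} := isOpen_lt hf continuous_const
  refine hU.measure_ne_zero (m.withDensity fun x => ENNReal.ofReal (f x)) ⟨x, hx⟩ ?_
  rw [withDensity_apply _ hU.measurableSet, setLIntegral_congr_fun hU.measurableSet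
    (fun y hy => ENNReal.ofReal_of_nonpos (le_of_lt hy)), lintegral_zero]

theorem isOpenPosMeasure_map_mulVec {d : ℕ} {Ω : Type*} [MeasurableSpace Ω] {μ : Measure Ω}
    [IsProbabilityMeasure μ] {Y : Ω → Matrix (Fin d) (Fin d) ℝ} (hY : Measurable Y)
    (hunit : ∀ᵐ ω ∂μ, IsUnit (Y ω).det) :
    ((μ.prod (stdGaussianPi d)).map fun p => Y p.1 *ᵥ p.2).IsOpenPosMeasure := by
  refine ⟨fun U hU hne h0 => ?_⟩
  obtain ⟨u, hu⟩ := hne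
  have hT : Measurable fun p : Ω × (Fin d → ℝ) => Y p.1 *ᵥ p.2 :=
    (hY.comp measurable_fst).matrix_mulVec measurable_snd
  rw [Measure.map_apply hT hU.measurableSet] at h0
  have h1 := Measure.ae_ae_of_ae_prod (measure_eq_zero_iff_ae_notMem.1 h0)
  obtain ⟨ω, hω, hω'⟩ := (h1.and hunit).exists
  have hV : IsOpen {z : Fin d → ℝ | Y ω *ᵥ z ∈ U} :=
    hU.preimage (Continuous.matrix_mulVec continuous_const continuous_id)
  refine hV.measure_ne_zero (stdGaussianPi d) ⟨(Y ω)⁻¹ *ᵥ u, ?_⟩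
    (measure_eq_zero_iff_ae_notMem.2 hω)
  simpa [Matrix.mul_nonsing_inv _ hω'] using hu

theorem dotProduct_fisherMatrix_mulVec {d : ℕ} {f : (Fin d → ℝ) → ℝ}
    (hf : ∀ v, Integrable fun x => fderiv ℝ f x v ^ 2 / f x) (v : Fin d → ℝ) :
    v ⬝ᵥ fisherMatrix d f *ᵥ v = ∫ x, fderiv ℝ f x v ^ 2 / f x := by
  have hF : ∀ i j : Fin d, Integrable fun x => (Matrix.of fun i j : Fin d =>
      fderiv ℝ f x (Pi.single i 1) * fderiv ℝ f x (Pi.single j 1) / f x) i j := by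
    intro i j
    refine (((hf (Pi.single i 1 + Pi.single j 1)).sub
      (hf (Pi.single i 1 - Pi.single j 1))).div_const 4).congr (ae_of_all _ fun x => ?_)
    simp only [Pi.sub_apply, map_add, map_sub, Matrix.of_apply]
    ring
  refine (dotProduct_integral_mulVec hF v).2.trans (integral_congr_ae (ae_of_all _ fun x => ?_))
  have hv : fderiv ℝ f x v = ∑ i, v i * fderiv ℝ f x (Pi.single i 1) := by
    conv_lhs => rw [pi_eq_sum_univ' v]
    simp [map_sum]
  simp only [dotProduct, Matrix.mulVec, Matrix.of_apply]
  rw [hv, sq, Finset.sum_mul_sum, Finset.sum_div]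
  refine Finset.sum_congr rfl fun i _ => ?_
  rw [Finset.mul_sum, Finset.sum_div]
  exact Finset.sum_congr rfl fun j _ => by ring

/-- The directional Fisher information of a Gaussian mixture `𝐘 Z` is at most `E|𝐘⁻¹v|²`. -/
theorem fisher_directional_bound_mixture {d : ℕ} {Ω : Type*} [MeasurableSpace Ω] {μ : Measure Ω}
    [IsProbabilityMeasure μ] {Y : Ω → Matrix (Fin d) (Fin d) ℝ} (hY : Measurable Y)
    (hunit : ∀ᵐ ω ∂μ, IsUnit (Y ω).det) {f : (Fin d → ℝ) → ℝ} (hf : ContDiff ℝ 1 f)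
    (hlaw : (μ.prod (stdGaussianPi d)).map (fun p => Y p.1 *ᵥ p.2) =
      volume.withDensity fun x => ENNReal.ofReal (f x))
    (v : Fin d → ℝ) (hv : Integrable (fun ω => ((Y ω)⁻¹ *ᵥ v) ⬝ᵥ ((Y ω)⁻¹ *ᵥ v)) μ) :
    Integrable (fun x => fderiv ℝ f x v ^ 2 / f x) ∧
      ∫ x, fderiv ℝ f x v ^ 2 / f x ≤ ∫ ω, ((Y ω)⁻¹ *ᵥ v) ⬝ᵥ ((Y ω)⁻¹ *ᵥ v) ∂μ := by
  have hf0 : ∀ x, 0 ≤ f x := by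
    have := isOpenPosMeasure_map_mulVec hY hunit
    rw [hlaw] at this
    exact nonneg_of_withDensity_isOpenPosMeasure (m := volume) hf.continuous
  have hT : Measurable fun p : Ω × (Fin d → ℝ) => Y p.1 *ᵥ p.2 :=
    (hY.comp measurable_fst).matrix_mulVec measurable_snd
  have hWm : Measurable fun p : Ω × (Fin d → ℝ) => ((Y p.1)⁻¹ *ᵥ v) ⬝ᵥ p.2 :=
    ((measurable_matrix_inv.comp (hY.comp measurable_fst)).matrix_mulVec
      measurable_const).dotProduct measurable_snd
  have hW2 : Integrable (fun p : Ω × (Fin d → ℝ) => (((Y p.1)⁻¹ *ᵥ v) ⬝ᵥ p.2) ^ 2)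
      (μ.prod (stdGaussianPi d)) := by
    have hsm : Measurable fun p : Ω × (Fin d → ℝ) => (((Y p.1)⁻¹ *ᵥ v) ⬝ᵥ p.2) ^ 2 :=
      hWm.pow_const 2
    refine (integrable_prod_iff hsm.aestronglyMeasurable).2 ⟨ae_of_all _ fun ω => ?_, ?_⟩
    · exact (memLp_dotProduct_stdGaussianPi ((Y ω)⁻¹ *ᵥ v)).integrable_sq
    · simpa [integral_dotProduct_sq_stdGaussianPi] using hv
  have hW : MemLp (fun p : Ω × (Fin d → ℝ) => ((Y p.1)⁻¹ *ᵥ v) ⬝ᵥ p.2) 2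
      (μ.prod (stdGaussianPi d)) :=
    (memLp_two_iff_integrable_sq hWm.aestronglyMeasurable).2 hW2
  have hWint : ∫ p, (((Y p.1)⁻¹ *ᵥ v) ⬝ᵥ p.2) ^ 2 ∂μ.prod (stdGaussianPi d) =
      ∫ ω, ((Y ω)⁻¹ *ᵥ v) ⬝ᵥ ((Y ω)⁻¹ *ᵥ v) ∂μ := by
    rw [integral_prod _ hW2]
    simp only [integral_dotProduct_sq_stdGaussianPi]
  rw [← hWint]
  refine fisher_directional_bound hf hf0 ⟨hT, hlaw⟩ hW v fun ψ hψ hψs => ?_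
  have hψ'c : Continuous fun x => fderiv ℝ ψ x v :=
    (hψ.continuous_fderiv one_ne_zero).clm_apply continuous_const
  obtain ⟨C, hC⟩ := hψs.exists_bound_of_continuous hψ.continuous
  obtain ⟨C', hC'⟩ := (hψs.fderiv_apply ℝ v).exists_bound_of_continuous hψ'c
  rw [integral_prod, integral_prod]
  · exact integral_congr_ae (hunit.mono fun ω hω =>
      integral_fderiv_comp_mulVec_stdGaussianPi hω hψ hψs v)
  · exact (hW.integrable one_le_two).bdd_mul
      (hψ.continuous.measurable.comp hT).aestronglyMeasurable (ae_of_all _ fun p => hC _)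
  · exact Integrable.of_bound (hψ'c.measurable.comp hT).aestronglyMeasurable C'
      (ae_of_all _ fun p => hC' _)

/-- If `X` is a centered Gaussian mixture in `ℝ^d`, distributed as `𝐘 Z` with `𝐘` an a.s.
positive definite random matrix and `Z` an independent standard Gaussian vector, and
`E‖(𝐘𝐘ᵀ)⁻¹‖_op < ∞`, then `𝓘(X) ⪯ E[(𝐘𝐘ᵀ)⁻¹]`. -/
theorem fisherMatrix_gaussianMixture_le
    (d : ℕ) {Ω : Type*} [MeasurableSpace Ω] (μ : Measure Ω) [IsProbabilityMeasure μ]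
    (Y : Ω → Matrix (Fin d) (Fin d) ℝ) (X : Ω → Fin d → ℝ)
    (hY : Measurable Y) (hX : Measurable X)
    (hpos : ∀ᵐ ω ∂μ, (Y ω).PosDef)
    (hlaw : μ.map X = (μ.prod (stdGaussianPi d)).map (fun p => (Y p.1).mulVec p.2))
    (hmom : Integrable (fun ω => matOpNorm ((Y ω * (Y ω)ᵀ)⁻¹)) μ) :
    loewnerLE (fisherInfoOfMeasure d (μ.map X))
      (Matrix.of fun i j => ∫ ω, ((Y ω * (Y ω)ᵀ)⁻¹) i j ∂μ) := by
  have hsym : ∀ M : Matrix (Fin d) (Fin d) ℝ, ∀ i j, (M * Mᵀ)⁻¹ i j = (M * Mᵀ)⁻¹ j i := by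
    intro M i j
    rw [← Matrix.transpose_apply (M * Mᵀ)⁻¹ i j, Matrix.transpose_nonsing_inv]
    simp
  have hAm : Measurable fun ω => (Y ω * (Y ω)ᵀ)⁻¹ := by
    refine measurable_matrix_inv.comp (measurable_matrix_of_apply fun i j => ?_)
    simp only [Matrix.mul_apply, Matrix.transpose_apply]
    exact Finset.measurable_fun_sum _ fun k _ =>
      ((measurable_matrix_apply i k).comp hY).mul ((measurable_matrix_apply j k).comp hY)
  have hAi : ∀ i j, Integrable (fun ω => (Y ω * (Y ω)ᵀ)⁻¹ i j) μ := fun i j =>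
    hmom.mono' ((measurable_matrix_apply i j).comp hAm).aestronglyMeasurable
      (ae_of_all _ fun ω => abs_apply_le_matOpNorm _ i j)
  have hquad := fun v => dotProduct_integral_mulVec hAi v
  simp only [dotProduct_inv_mul_transpose_mulVec] at hquad
  have hunit : ∀ᵐ ω ∂μ, IsUnit (Y ω).det := hpos.mono fun ω h => h.det_pos.ne'.isUnit
  have hbound : ∀ f : (Fin d → ℝ) → ℝ, ContDiff ℝ (⊤ : ℕ∞) f →
      μ.map X = volume.withDensity (fun x => ENNReal.ofReal (f x)) → ∀ v : Fin d → ℝ,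
      Integrable (fun x => fderiv ℝ f x v ^ 2 / f x) ∧
        ∫ x, fderiv ℝ f x v ^ 2 / f x ≤ ∫ ω, ((Y ω)⁻¹ *ᵥ v) ⬝ᵥ ((Y ω)⁻¹ *ᵥ v) ∂μ := by
    intro f hf hfX v
    obtain ⟨hi, hle⟩ := fisher_directional_bound_mixture hY hunit (hf.of_le (by norm_cast))
      (hlaw.symm.trans hfX) v (hquad v).1
    exact ⟨hi, hle⟩
  unfold loewnerLE fisherInfoOfMeasure
  refine Matrix.PosSemidef.of_dotProduct_mulVec_nonneg ?_ fun v => ?_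
  · ext i j
    split_ifs
    · simp [fisherMatrix, hsym _ i j, mul_comm]
    · simp [hsym _ i j]
  · rw [star_trivial, Matrix.sub_mulVec, dotProduct_sub, (hquad v).2, sub_nonneg]
    split_ifs with h
    · obtain ⟨hf, hfX⟩ := h.choose_spec
      obtain ⟨-, hle⟩ := hbound _ hf hfX v
      rwa [dotProduct_fisherMatrix_mulVec fun v => (hbound _ hf hfX v).1]
    · simpa using integral_nonneg fun ω => Finset.sum_nonneg fun i _ => mul_self_nonneg _
end
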